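/- The standard monomials in the minors p(A,B) of the generic r×d matrix X (with 1 ≤ |A| = |B| ≤ min(r,d)), including the empty monomial 1, form a basis of the polynomial ring K[Z] = K[x_{ij} : 1 ≤ i ≤ r, 1 ≤ j ≤ d] as a K-vector space. -/

import Mathlib

namespace SMB

/-- `geTup f g` : the strictly increasing tuple `f` is `≥` the strictly increasing tuple `g`
in the order on increasing tuples: the length of `f` is at most that of `g`, and `f` is
entrywise `≥` `g` (on the common range of indices). -/
def geTup {N s s' : ℕ} (f : Fin s → Fin N) (g : Fin s' → Fin N) : Prop :=
  ∃ h : s ≤ s', ∀ j : Fin s, g (Fin.castLE h j) ≤ f j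

/-- A strictly increasing `s`-tuple with values in `{1,…,N}` (encoded as `Fin N`). -/
structure IncTup (s N : ℕ) where
  f : Fin s → Fin N
  mono : StrictMono f

/-- A pair of strictly increasing tuples of a common length `s`: row indices in `{1,…,m}`
and column indices in `{1,…,q}`, indexing an `s × s` minor. -/
structure PairIx (m q : ℕ) where
  s : ℕ
  rows : Fin s → Fin m
  cols : Fin s → Fin q
  rmono : StrictMono rows
  cmono : StrictMono cols

/-- The partial order `(A,B) ⪰ (A',B')` on pairs of increasing tuples: `A ≥ A'` and `B ≥ B'`. -/
def PairIx.ge {m q : ℕ} (x y : PairIx m q) : Prop :=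
  geTup x.rows y.rows ∧ geTup x.cols y.cols

end SMB
namespace SMB

variable (K : Type) [Field K] (r d : ℕ)

/-- The polynomial ring `K[Z] = K[x_{ij} : 1 ≤ i ≤ r, 1 ≤ j ≤ d]` in the entries of a
generic `r×d` matrix `X`. -/
abbrev KZ := MvPolynomial (Fin r × Fin d) K

/-- The minor `p(A,B)` of the generic `r×d` matrix `X`, with row indices `A` and column
indices `B` (for the empty pair of tuples this is the constant `1`). -/
noncomputable def minorPoly (x : PairIx r d) : KZ K r d :=
  Matrix.det (Matrix.of fun i j : Fin x.s => MvPolynomial.X (x.rows i, x.cols j))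

/-- The ideal `I_t(X)` of `K[Z]` generated by all `t×t` minors of the generic `r×d` matrix. -/
noncomputable def minorIdeal (t : ℕ) : Ideal (KZ K r d) :=
  Ideal.span {f | ∃ x : PairIx r d, x.s = t ∧ f = minorPoly K r d x}

end SMB

namespace SMB

open MvPolynomial

theorem geTup.antisymm {N s s' : ℕ} {f : Fin s → Fin N} {g : Fin s' → Fin N}
    (h : geTup f g) (h' : geTup g f) : ∃ e : s = s', ∀ j, f j = g (Fin.cast e j) := by
  obtain ⟨h1, h2⟩ := h
  obtain ⟨h3, h4⟩ := h'
  obtain rfl : s = s' := le_antisymm h1 h3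
  exact ⟨rfl, fun j => le_antisymm (h4 j) (h2 j)⟩

theorem geTup.trans {N s s' s'' : ℕ} {f : Fin s → Fin N} {g : Fin s' → Fin N}
    {k : Fin s'' → Fin N} (h : geTup f g) (h' : geTup g k) : geTup f k := by
  obtain ⟨h1, h2⟩ := h
  obtain ⟨h3, h4⟩ := h'
  exact ⟨h1.trans h3, fun j => (h4 (Fin.castLE h1 j)).trans (h2 j)⟩

theorem PairIx.ge_trans {m q : ℕ} {x y z : PairIx m q} (h : x.ge y) (h' : y.ge z) : x.ge z :=
  ⟨h.1.trans h'.1, h.2.trans h'.2⟩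

theorem PairIx.ge_antisymm {m q : ℕ} {x y : PairIx m q} (h : x.ge y) (h' : y.ge x) : x = y := by
  obtain ⟨e, h1⟩ := h.1.antisymm h'.1
  obtain ⟨_, h2⟩ := h.2.antisymm h'.2
  rcases x with ⟨s, a, b, ha, hb⟩
  rcases y with ⟨s', a', b', ha', hb'⟩
  dsimp only at e
  subst e
  obtain rfl : a = a' := funext h1
  obtain rfl : b = b' := funext h2
  rfl

instance (r d : ℕ) : Trans (α := {x : PairIx r d // 0 < x.s}) (β := {x : PairIx r d // 0 < x.s})
    (γ := {x : PairIx r d // 0 < x.s}) (fun a b => PairIx.ge a.val b.val)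
    (fun a b => PairIx.ge a.val b.val) (fun a b => PairIx.ge a.val b.val) :=
  ⟨fun h h' => PairIx.ge_trans h h'⟩

section Lowest

variable {σ K : Type*} [Field K] (w : (σ →₀ ℕ) →+ ℕ)

/-- `m` is the unique monomial of `f` of minimal `w`-weight, and its coefficient is `1`. -/
def IsLowest (f : MvPolynomial σ K) (m : σ →₀ ℕ) : Prop :=
  f.coeff m = 1 ∧ ∀ m' ∈ f.support, m' ≠ m → w m < w m'

variable {w}

theorem IsLowest.one : IsLowest w (1 : MvPolynomial σ K) 0 := by
  classical
  refine ⟨by simp, fun m' hm' hne => absurd ?_ hne⟩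
  by_contra h
  rw [mem_support_iff, coeff_one, if_neg (Ne.symm h)] at hm'
  exact hm' rfl

theorem IsLowest.mul {f g : MvPolynomial σ K} {m n : σ →₀ ℕ} (hf : IsLowest w f m)
    (hg : IsLowest w g n) : IsLowest w (f * g) (m + n) := by
  classical
  have key : ∀ p ∈ f.support, ∀ q ∈ g.support, w m + w n ≤ w p + w q ∧
      (w p + w q = w m + w n → p = m ∧ q = n) := by
    intro p hp q hq
    have h1 := hf.2 p hp
    have h2 := hg.2 q hq
    by_cases hpm : p = m <;> by_cases hqn : q = n <;> simp_all <;> omega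
  constructor
  · rw [coeff_mul, Finset.sum_eq_single (m, n)]
    · rw [hf.1, hg.1, one_mul]
    · rintro ⟨p, q⟩ hpq hne
      rw [Finset.HasAntidiagonal.mem_antidiagonal] at hpq
      by_contra h
      have hp : p ∈ f.support := mem_support_iff.2 (left_ne_zero_of_mul h)
      have hq : q ∈ g.support := mem_support_iff.2 (right_ne_zero_of_mul h)
      have := congrArg w hpq
      rw [map_add, map_add] at this
      obtain ⟨rfl, rfl⟩ := (key p hp q hq).2 this
      exact hne rfl
    · simp
  · intro m' hm' hne
    obtain ⟨p, hp, q, hq, rfl⟩ := Finset.mem_add.1 (support_mul f g hm')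
    obtain ⟨h1, h2⟩ := key p hp q hq
    rw [map_add, map_add]
    refine lt_of_le_of_ne h1 fun h => hne ?_
    obtain ⟨rfl, rfl⟩ := h2 h.symm
    rfl

theorem IsLowest.list_prod {ι : Type*} {f : ι → MvPolynomial σ K} {m : ι → σ →₀ ℕ}
    (h : ∀ i, IsLowest w (f i) (m i)) (L : List ι) :
    IsLowest w (L.map f).prod (L.map m).sum := by
  induction L with
  | nil => exact IsLowest.one
  | cons a L ih => simpa using (h a).mul ih

theorem IsLowest.of_sum {ι : Type*} [Fintype ι] (ε : ι → K) (m : ι → σ →₀ ℕ) (i₀ : ι)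
    (h₀ : ε i₀ = 1) (h : ∀ i, ε i ≠ 0 → i ≠ i₀ → w (m i₀) < w (m i)) :
    IsLowest w (∑ i, monomial (m i) (ε i)) (m i₀) := by
  classical
  constructor
  · rw [coeff_sum, Finset.sum_eq_single i₀]
    · simp [h₀]
    · intro i _ hi
      rw [coeff_monomial]
      split_ifs with h1
      · by_contra h2
        exact (h i h2 hi).ne (by rw [h1])
      · rfl
    · simp
  · intro m' hm' hne
    rw [mem_support_iff, coeff_sum] at hm'
    obtain ⟨i, -, hi⟩ := Finset.exists_ne_zero_of_sum_ne_zero hm'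
    rw [coeff_monomial] at hi
    split_ifs at hi with h1
    · subst h1
      exact h i hi fun h2 => hne (by rw [h2])
    · exact absurd rfl hi

theorem linearIndependent_of_isLowest {ι : Type*} {f : ι → MvPolynomial σ K} {m : ι → σ →₀ ℕ}
    (hm : Function.Injective m) (h : ∀ i, IsLowest w (f i) (m i)) : LinearIndependent K f := by
  classical
  rw [linearIndependent_iff]
  intro l hl
  by_contra hne
  obtain ⟨i₀, hi₀, hmin⟩ := l.support.exists_min_image (fun i => w (m i))
    (Finsupp.support_nonempty_iff.2 hne)
  have hc := congrArg (coeff (m i₀)) hl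
  rw [Finsupp.linearCombination_apply, Finsupp.sum, coeff_sum, Finset.sum_eq_single i₀] at hc
  · rw [coeff_smul, (h i₀).1, smul_eq_mul, mul_one, coeff_zero] at hc
    exact (Finsupp.mem_support_iff.1 hi₀) hc
  · intro i hi hne'
    rw [coeff_smul]
    by_contra hcoef
    have := (h i).2 (m i₀) (mem_support_iff.2 (right_ne_zero_of_mul hcoef)) (fun e => hne' (hm e).symm)
    exact absurd (hmin i hi) (not_le.2 this)
  · exact fun h' => absurd hi₀ h'

end Lowest

theorem sum_val_le_sum {n : ℕ} (c : Fin n → ℕ) (hc : Function.Injective c) :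
    ∑ i : Fin n, (i : ℕ) ≤ ∑ i, c i := by
  have h := Finset.sum_range_le_sum (s := Finset.univ.image fun i => (c i : ℤ)) (c := 0) (by simp)
  have hinj : Function.Injective fun i => (c i : ℤ) := Nat.cast_injective.comp hc
  rw [Finset.sum_image hinj.injOn, Finset.card_image_of_injective _ hinj, Finset.card_fin,
    ← Fin.sum_univ_eq_sum_range fun i => (0 : ℤ) + i] at h
  simpa only [zero_add, ← Nat.cast_sum, Nat.cast_le] using h

/-- A rearrangement inequality: strictly decreasing positive weights are paired most cheaply
with the naturals `0, 1, 2, …` in order. -/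
theorem sum_mul_val_le {n : ℕ} (F : Fin n → ℕ) (hF : StrictAnti F) (hpos : ∀ i, 0 < F i)
    (c : Fin n → ℕ) (hc : Function.Injective c) :
    ∑ i, F i * (i : ℕ) ≤ ∑ i, F i * c i ∧
      (∑ i, F i * c i = ∑ i, F i * (i : ℕ) → ∀ i, c i = i) := by
  induction n with
  | zero => simp
  | succ n ih =>
    obtain ⟨h1, h2⟩ := ih (fun i => F i.castSucc - F (Fin.last n))
      (fun i j hij => by
        have := hF (Fin.castSucc_lt_castSucc_iff.2 hij)
        have := hF (Fin.castSucc_lt_last j)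
        dsimp only; omega)
      (fun i => by have := hF (Fin.castSucc_lt_last i); omega)
      (fun i => c i.castSucc) (fun i j hij => Fin.castSucc_injective _ (hc hij))
    have split : ∀ e : Fin (n + 1) → ℕ, ∑ i, F i * e i =
        ∑ i : Fin n, (F i.castSucc - F (Fin.last n)) * e i.castSucc +
          F (Fin.last n) * ∑ i, e i := by
      intro e
      rw [Fin.sum_univ_castSucc, Fin.sum_univ_castSucc (f := e), mul_add, ← add_assoc,
        Finset.mul_sum, ← Finset.sum_add_distrib]
      congr 1
      refine Finset.sum_congr rfl fun i _ => ?_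
      rw [← add_mul, Nat.sub_add_cancel (hF (Fin.castSucc_lt_last i)).le]
    have h3 := sum_val_le_sum c hc
    have h4 := Nat.mul_le_mul_left (F (Fin.last n)) h3
    rw [split c, split fun i => (i : ℕ)]
    simp only [Fin.val_castSucc]
    refine ⟨add_le_add h1 h4, fun h => ?_⟩
    have h5 := h2 (by omega)
    have h6 : ∑ i, c i = ∑ i : Fin (n + 1), (i : ℕ) :=
      Nat.eq_of_mul_eq_mul_left (hpos (Fin.last n)) (by omega)
    rw [Fin.sum_univ_castSucc, Fin.sum_univ_castSucc, Finset.sum_congr rfl fun i _ => h5 i] at h6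
    simp only [Fin.val_castSucc] at h6
    exact Fin.lastCases (by simpa using h6) h5

end SMB

namespace SMB

open MvPolynomial

section Independence

variable (K : Type) [Field K] {r d : ℕ}

theorem PairIx.s_le (x : PairIx r d) : x.s ≤ r := by
  simpa using Fintype.card_le_of_injective _ x.rmono.injective

/-- The substitution replacing the generic matrix by a product of generic `r × r` and `r × d`
matrices. -/
noncomputable def productSubst :
    KZ K r d →ₐ[K] MvPolynomial ((Fin r × Fin r) ⊕ (Fin r × Fin d)) K :=
  aeval fun p => ∑ c, X (Sum.inl (p.1, c)) * X (Sum.inr (c, p.2))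

/-- Weights for which the main term of every minor of the product matrix has minimal weight. -/
noncomputable def productWeight (r d : ℕ) : (((Fin r × Fin r) ⊕ (Fin r × Fin d)) →₀ ℕ) →+ ℕ :=
  Finsupp.weight (Sum.elim (fun p => (r - p.1) * (p.2 : ℕ)) fun p => (d - p.2) * (p.1 : ℕ))

/-- The monomial `∏ u (A i, c i) * ∏ v (c (τ j), B j)`. -/
noncomputable def productTerm (x : PairIx r d) (c : Fin x.s → Fin r) (τ : Equiv.Perm (Fin x.s)) :
    ((Fin r × Fin r) ⊕ (Fin r × Fin d)) →₀ ℕ :=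
  ∑ i, Finsupp.single (Sum.inl (x.rows i, c i)) 1 +
    ∑ j, Finsupp.single (Sum.inr (c (τ j), x.cols j)) 1

/-- The term of minimal weight of the minor of the product matrix. -/
noncomputable def mainTerm (x : PairIx r d) : ((Fin r × Fin r) ⊕ (Fin r × Fin d)) →₀ ℕ :=
  productTerm x (Fin.castLE x.s_le) 1

theorem productWeight_productTerm (x : PairIx r d) (c : Fin x.s → Fin r)
    (τ : Equiv.Perm (Fin x.s)) : productWeight r d (productTerm x c τ) =
      ∑ i, (r - x.rows i) * (c i : ℕ) + ∑ j, (d - x.cols j) * (c (τ j) : ℕ) := by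
  simp [productTerm, productWeight, Finsupp.weight_single]

theorem productWeight_mainTerm_lt (x : PairIx r d) (c : Fin x.s → Fin r)
    (hc : Function.Injective c) (τ : Equiv.Perm (Fin x.s))
    (hne : (c, τ) ≠ (Fin.castLE x.s_le, 1)) :
    productWeight r d (mainTerm x) < productWeight r d (productTerm x c τ) := by
  have hrow := sum_mul_val_le (fun i => r - (x.rows i : ℕ))
    (fun i j hij => by have : x.rows i < x.rows j := x.rmono hij; dsimp only; omega)
    (fun i => by omega) (fun i => (c i : ℕ)) (Fin.val_injective.comp hc)
  have hcol := sum_mul_val_le (fun i => d - (x.cols i : ℕ))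
    (fun i j hij => by have : x.cols i < x.cols j := x.cmono hij; dsimp only; omega)
    (fun i => by omega) (fun i => (c (τ i) : ℕ))
    (Fin.val_injective.comp (hc.comp τ.injective))
  rw [mainTerm, productWeight_productTerm, productWeight_productTerm]
  simp only [Fin.val_castLE, Equiv.Perm.coe_one, id]
  refine lt_of_le_of_ne (add_le_add hrow.1 hcol.1) fun h => hne ?_
  have h1 := hrow.2 (by have := hrow.1; have := hcol.1; omega)
  have h2 := hcol.2 (by have := hrow.1; have := hcol.1; omega)
  refine Prod.ext (funext fun i => Fin.ext (h1 i)) (Equiv.ext fun i => Fin.ext ?_)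
  rw [← h1, h2]
  rfl

theorem productSubst_minorPoly (x : PairIx r d) : productSubst K (minorPoly K r d x) =
    ∑ p : (Fin x.s → Fin r) × Equiv.Perm (Fin x.s), monomial (productTerm x p.1 p.2)
      (open Classical in if Function.Injective p.1 then ((Equiv.Perm.sign p.2 : ℤ) : K) else 0) := by
  classical
  have h1 : productSubst K (minorPoly K r d x) =
      Matrix.detRowAlternating fun i => ∑ c : Fin r,
        (X (Sum.inl (x.rows i, c)) : MvPolynomial ((Fin r × Fin r) ⊕ (Fin r × Fin d)) K) •
          fun j => X (Sum.inr (c, x.cols j)) := by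
    rw [minorPoly, AlgHom.map_det]
    change Matrix.det _ = Matrix.det _
    congr 1
    ext i j : 2
    simp [productSubst, Finset.sum_apply]
  rw [h1, ← AlternatingMap.coe_multilinearMap, MultilinearMap.map_sum, Fintype.sum_prod_type]
  refine Finset.sum_congr rfl fun c _ => ?_
  rw [MultilinearMap.map_smul_univ, AlternatingMap.coe_multilinearMap]
  dsimp only
  split_ifs with hc
  · change _ • Matrix.det (Matrix.of fun i j => X (Sum.inr (c i, x.cols j))) = _
    rw [Matrix.det_apply', Finset.smul_sum]
    refine Finset.sum_congr rfl fun τ _ => ?_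
    rw [productTerm, ← mul_one ((Equiv.Perm.sign τ : ℤ) : K), ← C_mul_monomial, ← one_mul (1 : K),
      ← monomial_mul, monomial_sum_one, monomial_sum_one, smul_eq_mul, map_intCast, mul_left_comm]
    rfl
  · simp only [monomial_zero, Finset.sum_const_zero]
    simp only [Function.Injective, not_forall] at hc
    obtain ⟨i, j, hij, hne⟩ := hc
    rw [AlternatingMap.map_eq_zero_of_eq _ _ (by simp only [hij]) hne, smul_zero]

theorem isLowest_productSubst_minorPoly (x : PairIx r d) :
    IsLowest (productWeight r d) (productSubst K (minorPoly K r d x)) (mainTerm x) := by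
  rw [productSubst_minorPoly]
  refine IsLowest.of_sum _ (fun p : (Fin x.s → Fin r) × Equiv.Perm (Fin x.s) =>
    productTerm x p.1 p.2) (Fin.castLE x.s_le, 1) ?_ ?_
  · simp [Fin.castLE_injective]
  · rintro ⟨c, τ⟩ hε hne
    refine productWeight_mainTerm_lt x c ?_ τ hne
    by_contra h
    exact hε (if_neg h)

theorem mainTerm_inl_ne_zero (x : PairIx r d) (a c : Fin r) :
    mainTerm x (Sum.inl (a, c)) ≠ 0 ↔ ∃ i, x.rows i = a ∧ Fin.castLE x.s_le i = c := by
  classical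
  simp [mainTerm, productTerm, Finsupp.single_apply]

theorem mainTerm_inr_ne_zero (x : PairIx r d) (c : Fin r) (b : Fin d) :
    mainTerm x (Sum.inr (c, b)) ≠ 0 ↔ ∃ i, Fin.castLE x.s_le i = c ∧ x.cols i = b := by
  classical
  simp [mainTerm, productTerm, Finsupp.single_apply]

theorem sum_mainTerm_ne_zero (L : List {x : PairIx r d // 0 < x.s}) (v) :
    (L.map fun x => mainTerm x.val).sum v ≠ 0 ↔ ∃ x ∈ L, mainTerm x.val v ≠ 0 := by
  induction L with
  | nil => simp
  | cons a L ih =>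
    simp only [List.map_cons, List.sum_cons, Finsupp.add_apply, List.mem_cons, exists_eq_or_imp,
      ← ih]
    omega

theorem ge_of_sum_mainTerm_eq {L L' : List {x : PairIx r d // 0 < x.s}}
    (h : (L.map fun x => mainTerm x.val).sum = (L'.map fun x => mainTerm x.val).sum)
    {x y : {x : PairIx r d // 0 < x.s}} (hx : x ∈ L) (hy : ∀ z ∈ L', PairIx.ge z.val y.val) :
    PairIx.ge x.val y.val := by
  have hrow : ∀ i : Fin x.val.s, ∃ h : (i : ℕ) < y.val.s, y.val.rows ⟨i, h⟩ ≤ x.val.rows i := by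
    intro i
    have h1 := (sum_mainTerm_ne_zero L _).2 ⟨x, hx, (mainTerm_inl_ne_zero x.val _ _).2 ⟨i, rfl, rfl⟩⟩
    rw [h] at h1
    obtain ⟨z, hz, h2⟩ := (sum_mainTerm_ne_zero L' _).1 h1
    obtain ⟨k, hk, hki⟩ := (mainTerm_inl_ne_zero z.val _ _).1 h2
    obtain ⟨hs, hle⟩ := (hy z hz).1
    have hki' : (k : ℕ) = i := congrArg Fin.val hki
    refine ⟨by omega, ?_⟩
    rw [← hk]
    exact le_of_eq_of_le (congrArg _ (Fin.ext hki'.symm)) (hle k)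
  have hcol : ∀ i : Fin x.val.s, ∃ h : (i : ℕ) < y.val.s, y.val.cols ⟨i, h⟩ ≤ x.val.cols i := by
    intro i
    have h1 := (sum_mainTerm_ne_zero L _).2 ⟨x, hx, (mainTerm_inr_ne_zero x.val _ _).2 ⟨i, rfl, rfl⟩⟩
    rw [h] at h1
    obtain ⟨z, hz, h2⟩ := (sum_mainTerm_ne_zero L' _).1 h1
    obtain ⟨k, hki, hk⟩ := (mainTerm_inr_ne_zero z.val _ _).1 h2
    obtain ⟨hs, hle⟩ := (hy z hz).2
    have hki' : (k : ℕ) = i := congrArg Fin.val hki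
    refine ⟨by omega, ?_⟩
    rw [← hk]
    exact le_of_eq_of_le (congrArg _ (Fin.ext hki'.symm)) (hle k)
  have hs : x.val.s ≤ y.val.s := by
    by_contra hlt
    obtain ⟨h1, -⟩ := hrow ⟨y.val.s, not_le.1 hlt⟩
    exact lt_irrefl _ h1
  exact ⟨⟨hs, fun j => (hrow j).2⟩, ⟨hs, fun j => (hcol j).2⟩⟩

theorem sum_mainTerm_ne_zero_of_mem {L : List {x : PairIx r d // 0 < x.s}}
    {x : {x : PairIx r d // 0 < x.s}} (hx : x ∈ L) : (L.map fun x => mainTerm x.val).sum ≠ 0 := by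
  intro h
  exact (sum_mainTerm_ne_zero L _).2
    ⟨x, hx, (mainTerm_inl_ne_zero x.val _ _).2 ⟨⟨0, x.2⟩, rfl, rfl⟩⟩ (by rw [h]; rfl)

theorem sum_mainTerm_injective (L L' : List {x : PairIx r d // 0 < x.s})
    (hL : L.Pairwise fun a b => PairIx.ge a.val b.val)
    (hL' : L'.Pairwise fun a b => PairIx.ge a.val b.val)
    (h : (L.map fun x => mainTerm x.val).sum = (L'.map fun x => mainTerm x.val).sum) :
    L = L' := by
  have refl : ∀ x : PairIx r d, x.ge x := fun x => ⟨⟨le_rfl, fun _ => le_rfl⟩, ⟨le_rfl, fun _ => le_rfl⟩⟩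
  induction L using List.reverseRecOn generalizing L' with
  | nil =>
    by_contra hne
    obtain ⟨x, hx⟩ := List.exists_mem_of_ne_nil L' (Ne.symm hne)
    exact sum_mainTerm_ne_zero_of_mem hx h.symm
  | append_singleton M x ih =>
    rcases List.eq_nil_or_concat L' with rfl | ⟨M', x', rfl⟩
    · exact absurd h (sum_mainTerm_ne_zero_of_mem (x := x) (by simp))
    · simp only [List.concat_eq_append] at *
      rw [List.pairwise_append] at hL hL'
      have hmin : ∀ {M : List {x : PairIx r d // 0 < x.s}} {x},
          (∀ a ∈ M, ∀ b ∈ [x], PairIx.ge a.val b.val) → ∀ z ∈ M ++ [x], PairIx.ge z.val x.val := by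
        intro M x h z hz
        rcases List.mem_append.1 hz with hz | hz
        · exact h z hz x (by simp)
        · rw [List.mem_singleton.1 hz]
          exact refl _
      have h1 := ge_of_sum_mainTerm_eq h (x := x) (y := x') (by simp) (hmin hL'.2.2)
      have h2 := ge_of_sum_mainTerm_eq h.symm (x := x') (y := x) (by simp) (hmin hL.2.2)
      obtain rfl : x = x' := Subtype.ext (PairIx.ge_antisymm h1 h2)
      simp only [List.map_append, List.sum_append, add_left_inj] at h
      rw [ih M' hL.1 hL'.1 h]

theorem linearIndependent_standard : LinearIndependent K
    (fun L : {L : List {x : PairIx r d // 0 < x.s} //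
        L.IsChain fun a b => PairIx.ge a.val b.val} =>
      (L.val.map fun x => minorPoly K r d x.val).prod) := by
  refine LinearIndependent.of_comp (productSubst K).toLinearMap ?_
  refine linearIndependent_of_isLowest (w := productWeight r d)
    (m := fun L => (L.val.map fun x => mainTerm x.val).sum) ?_ ?_
  · intro L L' h
    exact Subtype.ext (sum_mainTerm_injective _ _ (List.isChain_iff_pairwise.1 L.2)
      (List.isChain_iff_pairwise.1 L'.2) h)
  · intro L
    simp only [Function.comp_apply, AlgHom.toLinearMap_apply, map_list_prod, List.map_map]
    exact IsLowest.list_prod (fun x : {x : PairIx r d // 0 < x.s} =>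
      isLowest_productSubst_minorPoly K x.val) L.val

end Independence

end SMB

namespace SMB

section Exchange

variable {R : Type*} [CommRing R] {n : ℕ} {E : Type*}

/-- The determinant of the square matrix whose rows are the vectors `Y (c i)`. -/
def bracket (Y : E → Fin n → R) (c : Fin n → E) : R :=
  Matrix.det (Matrix.of fun i => Y (c i))

/-- The determinant as an alternating function of the rows with index satisfying `p`,
the other rows being those of `z`. -/
def partialDet (p : Fin n → Prop) [DecidablePred p] (z : Fin n → Fin n → R) :
    (Fin n → R) [⋀^{i // p i}]→ₗ[R] R :=
  { (Matrix.detRowAlternating (R := R) (n := Fin n)).toMultilinearMap.domDomRestrict p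
      (fun i => z i) with
    map_eq_zero_of_eq' := fun v i j hv hij => by
      refine (Matrix.detRowAlternating (R := R) (n := Fin n)).map_eq_zero_of_eq _
        (i := i) (j := j) ?_ (fun h => hij (Subtype.ext h))
      simp only [i.2, j.2, dite_true]
      exact hv }

theorem partialDet_apply (p : Fin n → Prop) [DecidablePred p] (Y : E → Fin n → R) (c : Fin n → E)
    (e : {i // p i} → E) : partialDet p (fun i => Y (c i)) (fun i => Y (e i)) =
      bracket Y (fun i => if h : p i then e ⟨i, h⟩ else c i) := by
  change Matrix.det _ = Matrix.det _
  congr 1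
  ext i j
  by_cases h : p i <;> simp [h]

theorem sum_apply_perm_inl_lt {ι κ : Type*} [Fintype ι] [Fintype κ] [DecidableEq ι] [DecidableEq κ]
    (g : ι ⊕ κ → ℕ) (t : ℕ) (hl : ∀ i, t ≤ g (Sum.inl i)) (hr : ∀ k, g (Sum.inr k) < t)
    (σ : Equiv.Perm (ι ⊕ κ)) (hσ : σ ∉ (Equiv.Perm.sumCongrHom ι κ).range) :
    ∑ i, g (σ (Sum.inl i)) < ∑ i, g (Sum.inl i) := by
  classical
  set S : Finset (ι ⊕ κ) := Finset.univ.map Function.Embedding.inl with hS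
  set T : Finset (ι ⊕ κ) := S.map σ.toEmbedding with hT
  have hcard : T.card = S.card := Finset.card_map _
  have hsumS : ∑ i, g (Sum.inl i) = ∑ x ∈ S, g x := by simp [hS]
  have hsumT : ∑ i, g (σ (Sum.inl i)) = ∑ x ∈ T, g x := by simp [hT, hS]
  have hmemS : ∀ x, x ∈ S → t ≤ g x := by
    intro x hx
    obtain ⟨i, -, rfl⟩ := Finset.mem_map.1 hx
    exact hl i
  have hnot : ∀ x, x ∉ S → g x < t := by
    rintro (i | k) hx
    · exact absurd (Finset.mem_map.2 ⟨i, Finset.mem_univ _, rfl⟩) hx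
    · exact hr k
  have hne : (T \ S).Nonempty := by
    rw [Finset.sdiff_nonempty]
    intro hsub
    refine hσ (Equiv.Perm.mem_sumCongrHom_range_of_perm_mapsTo_inl ?_)
    rintro _ ⟨i, rfl⟩
    have : σ (Sum.inl i) ∈ S := hsub (by simp [hT, hS])
    obtain ⟨j, -, hj⟩ := Finset.mem_map.1 this
    exact ⟨j, hj⟩
  rw [hsumS, hsumT, ← Finset.sum_inter_add_sum_sdiff T S, ← Finset.sum_inter_add_sum_sdiff S T,
    Finset.inter_comm S T]
  refine Nat.add_lt_add_left ?_ _
  calc ∑ x ∈ T \ S, g x < ∑ _x ∈ T \ S, t :=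
        Finset.sum_lt_sum_of_nonempty hne fun x hx => hnot x (Finset.mem_sdiff.1 hx).2
    _ = ∑ _x ∈ S \ T, t := by
        rw [Finset.sum_const, Finset.sum_const, Finset.card_sdiff_comm hcard]
    _ ≤ ∑ x ∈ S \ T, g x := Finset.sum_le_sum fun x hx => hmemS x (Finset.mem_sdiff.1 hx).1

theorem sum_dite_add {p : Fin n → Prop} [DecidablePred p] (key : E → ℕ) (c : Fin n → E)
    (e : {i // p i} → E) : ∑ i, key (if h : p i then e ⟨i, h⟩ else c i) =
      ∑ i, key (e i) + ∑ i : {i // ¬ p i}, key (c i) := by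
  rw [← Fintype.sum_subtype_add_sum_subtype p]
  congr 1
  · exact Finset.sum_congr rfl fun i _ => by rw [dif_pos i.2]
  · exact Finset.sum_congr rfl fun i _ => by rw [dif_neg i.2]

/-- The exchange relation: if `c` has fewer keys below `t` than `c'`, the product of their brackets
is a combination of products in which the keys of the first factor have a smaller sum. -/
theorem bracket_mul_bracket_mem [IsDomain R] (Y : E → Fin n → R) (key : E → ℕ) (c c' : Fin n → E)
    (t : ℕ) (h : Fintype.card {i // key (c i) < t} < Fintype.card {i // key (c' i) < t}) :
    bracket Y c * bracket Y c' ∈ Submodule.span ℤ {f | ∃ e e' : Fin n → E,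
      f = bracket Y e * bracket Y e' ∧ ∑ i, key (e i) < ∑ i, key (c i) ∧
        ∑ i, key (e i) + ∑ i, key (e' i) = ∑ i, key (c i) + ∑ i, key (c' i)} := by
  classical
  set p : Fin n → Prop := fun i => ¬ key (c i) < t
  set q : Fin n → Prop := fun i => key (c' i) < t
  set u : {i // p i} ⊕ {i // q i} → E := Sum.elim (fun i => c i) fun i => c' i with hu
  set a := partialDet p fun i => Y (c i) with ha
  set b := partialDet q fun i => Y (c' i) with hb
  have hterm : ∀ σ : Equiv.Perm ({i // p i} ⊕ {i // q i}),
      LinearMap.mul' R R (AlternatingMap.domCoprod.summand a b (Quotient.mk'' σ) fun x => Y (u x)) =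
      (Equiv.Perm.sign σ : ℤ) •
        (bracket Y (fun i => if h : p i then u (σ (Sum.inl ⟨i, h⟩)) else c i) *
          bracket Y (fun i => if h : q i then u (σ (Sum.inr ⟨i, h⟩)) else c' i)) := by
    intro σ
    rw [AlternatingMap.domCoprod.summand_mk'', ← partialDet_apply p Y c fun i => u (σ (Sum.inl i)),
      ← partialDet_apply q Y c' fun i => u (σ (Sum.inr i)), ← ha, ← hb]
    rw [_root_.smul_apply, MultilinearMap.domDomCongr_apply,
      MultilinearMap.domCoprod_apply, Units.smul_def, map_zsmul, LinearMap.mul'_apply]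
    rfl
  have hzero : LinearMap.mul' R R (a.domCoprod b fun x => Y (u x)) = 0 := by
    refine ((LinearMap.mul' R R).compAlternatingMap (a.domCoprod b)).map_linearDependent _ ?_
    intro hli
    have h1 := hli.fintype_card_le_finrank
    have hp : Fintype.card {i // p i} = n - Fintype.card {i // key (c i) < t} := by
      exact (Fintype.card_subtype_compl _).trans (by rw [Fintype.card_fin])
    have hq : Fintype.card {i // q i} = Fintype.card {i // key (c' i) < t} :=
      Fintype.card_congr (Equiv.refl _)
    rw [Module.finrank_fin_fun, Fintype.card_sum, hp, hq] at h1
    have h2 := Fintype.card_subtype_le fun i => key (c i) < t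
    rw [Fintype.card_fin] at h2
    omega
  have hsum : ∑ σ, LinearMap.mul' R R (AlternatingMap.domCoprod.summand a b σ fun x => Y (u x)) = 0 := by
    rw [← hzero, AlternatingMap.domCoprod_apply, _root_.sum_apply, map_sum]
  have hone : LinearMap.mul' R R
      (AlternatingMap.domCoprod.summand a b (Quotient.mk'' 1) fun x => Y (u x)) =
      bracket Y c * bracket Y c' := by
    rw [hterm]
    simp [hu]
  have hsplit := Finset.add_sum_erase Finset.univ (fun σ : Equiv.Perm.ModSumCongr _ _ =>
    LinearMap.mul' R R (AlternatingMap.domCoprod.summand a b σ fun x => Y (u x)))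
    (Finset.mem_univ (Quotient.mk'' 1))
  rw [hsum, hone, add_eq_zero_iff_eq_neg] at hsplit
  rw [hsplit]
  refine neg_mem (Submodule.sum_mem _ fun σ hσ => ?_)
  induction σ using Quotient.inductionOn' with | _ σ
  rw [hterm]
  apply zsmul_mem
  refine Submodule.subset_span ⟨_, _, rfl, ?_, ?_⟩
  · have hσ' : σ ∉ (Equiv.Perm.sumCongrHom {i // p i} {i // q i}).range := by
      intro hmem
      refine Finset.ne_of_mem_erase hσ (Quotient.sound' ?_)
      rw [QuotientGroup.leftRel_apply, mul_one]
      exact inv_mem hmem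
    have hlt := sum_apply_perm_inl_lt (fun x => key (u x)) t (fun i => not_lt.1 i.2) (fun i => i.2)
      σ hσ'
    rw [sum_dite_add key c fun i => u (σ (Sum.inl i)),
      ← Fintype.sum_subtype_add_sum_subtype p fun i => key (c i)]
    exact Nat.add_lt_add_right hlt _
  · have htot := Equiv.sum_comp σ fun x => key (u x)
    rw [Fintype.sum_sum_type, Fintype.sum_sum_type] at htot
    rw [sum_dite_add key c fun i => u (σ (Sum.inl i)), sum_dite_add key c' fun i => u (σ (Sum.inr i)),
      ← Fintype.sum_subtype_add_sum_subtype p fun i => key (c i),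
      ← Fintype.sum_subtype_add_sum_subtype q fun i => key (c' i)]
    simp only [hu, Sum.elim_inl, Sum.elim_inr] at htot ⊢
    omega

/-- The number of entries of `c` with key below `t`. -/
def countBelow (key : E → ℕ) (c : Fin n → E) (t : ℕ) : ℕ :=
  Fintype.card {i // key (c i) < t}

/-- Products of brackets of pairwise comparable tuples span all products of brackets. -/
theorem prod_bracket_mem_span (K : Type*) [CommRing K] [Algebra K R] [IsDomain R] (Y : E → Fin n → R)
    (key : E → ℕ) (B : ℕ) (hB : ∀ e, key e ≤ B) (m : Multiset (Fin n → E)) :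
    (m.map (bracket Y)).prod ∈ Submodule.span K {f | ∃ m' : Multiset (Fin n → E),
      (∀ c ∈ m', ∀ c' ∈ m', (∀ t, countBelow key c t ≤ countBelow key c' t) ∨
        ∀ t, countBelow key c' t ≤ countBelow key c t) ∧ f = (m'.map (bracket Y)).prod} := by
  have hw : ∀ c : Fin n → E, (∑ i, key (c i)) ^ 2 ≤ (n * B) ^ 2 := fun c =>
    Nat.pow_le_pow_left ((Finset.sum_le_sum fun i _ => hB (c i)).trans (by simp)) 2
  induction hk : m.card * (n * B) ^ 2 - (m.map fun c => (∑ i, key (c i)) ^ 2).sum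
    using Nat.strong_induction_on generalizing m with
  | _ k ih =>
  subst hk
  by_cases hcomp : ∀ c ∈ m, ∀ c' ∈ m, (∀ t, countBelow key c t ≤ countBelow key c' t) ∨
      ∀ t, countBelow key c' t ≤ countBelow key c t
  · exact Submodule.subset_span ⟨m, hcomp, rfl⟩
  have hpair : ∃ c ∈ m, ∃ c' ∈ m, c ≠ c' ∧ ∑ i, key (c i) ≤ ∑ i, key (c' i) ∧
      ∃ t, countBelow key c t < countBelow key c' t := by
    push Not at hcomp
    obtain ⟨c, hc, c', hc', ⟨t, ht⟩, t', ht'⟩ := hcomp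
    have hne : c ≠ c' := by
      rintro rfl
      exact lt_irrefl _ ht
    rcases le_total (∑ i, key (c i)) (∑ i, key (c' i)) with hle | hle
    · exact ⟨c, hc, c', hc', hne, hle, t', ht'⟩
    · exact ⟨c', hc', c, hc, hne.symm, hle, t, ht⟩
  obtain ⟨c, hc, c', hc', hne, hle, t, ht⟩ := hpair
  obtain ⟨m₁, rfl⟩ := Multiset.exists_cons_of_mem hc
  obtain ⟨m₀, rfl⟩ := Multiset.exists_cons_of_mem
    ((Multiset.mem_cons.1 hc').resolve_left hne.symm)
  have hmem := bracket_mul_bracket_mem Y key c c' t ht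
  rw [Multiset.map_cons, Multiset.map_cons, Multiset.prod_cons, Multiset.prod_cons, ← mul_assoc]
  generalize bracket Y c * bracket Y c' = F at hmem
  induction hmem using Submodule.span_induction with
  | mem f hf =>
    obtain ⟨e, e', rfl, hlt, heq⟩ := hf
    have := ih _ ?_ (e ::ₘ e' ::ₘ m₀) rfl
    · simpa [mul_assoc] using this
    · have hbound : ∀ s : Multiset (Fin n → E),
          (s.map fun c => (∑ i, key (c i)) ^ 2).sum ≤ s.card * (n * B) ^ 2 := by
        intro s
        simpa using Multiset.sum_le_card_nsmul (s.map fun c => (∑ i, key (c i)) ^ 2) ((n * B) ^ 2)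
          (by simpa using fun c _ => hw c)
      have h1 := hbound (e ::ₘ e' ::ₘ m₀)
      have h2 : (∑ i, key (c i)) ^ 2 + (∑ i, key (c' i)) ^ 2 <
          (∑ i, key (e i)) ^ 2 + (∑ i, key (e' i)) ^ 2 := by
        generalize ∑ i, key (c i) = x at *
        generalize ∑ i, key (c' i) = y at *
        generalize ∑ i, key (e i) = z at *
        generalize ∑ i, key (e' i) = w at *
        obtain ⟨k, rfl⟩ := Nat.exists_eq_add_of_lt hlt
        obtain rfl : w = y + (k + 1) := by omega
        nlinarith
      simp only [Multiset.card_cons, Multiset.map_cons, Multiset.sum_cons] at h1 ⊢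
      omega
  | zero => simp
  | add f g _ _ hf hg => rw [add_mul]; exact add_mem hf hg
  | smul z f _ hf => rw [smul_mul_assoc]; exact zsmul_mem hf z

end Exchange

theorem exists_perm_pairwise {α : Type*} (P : α → α → Prop) (htrans : ∀ a b c, P a b → P b c → P a c)
    (l : List α) (h : ∀ a ∈ l, ∀ b ∈ l, P a b ∨ P b a) : ∃ l' : List α, l'.Perm l ∧ l'.Pairwise P := by
  classical
  induction l with
  | nil => exact ⟨[], List.Perm.refl _, List.Pairwise.nil⟩
  | cons a l ih =>
    obtain ⟨l', hperm, hpw⟩ := ih fun b hb c hc =>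
      h b (List.mem_cons_of_mem _ hb) c (List.mem_cons_of_mem _ hc)
    refine ⟨l'.filter (fun b => P b a) ++ a :: l'.filter (fun b => ¬ P b a), ?_, ?_⟩
    · refine List.perm_middle.trans (List.Perm.cons a (List.Perm.trans ?_ hperm))
      simpa using List.filter_append_perm (fun b => decide (P b a)) l'
    · have habove : ∀ b ∈ l', ¬ P b a → P a b := fun b hb hba =>
        (h a (by simp) b (List.mem_cons_of_mem _ (hperm.subset hb))).resolve_right hba
      refine List.pairwise_append.2 ⟨hpw.filter _, List.pairwise_cons.2 ⟨?_, hpw.filter _⟩, ?_⟩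
      · intro b hb
        simp only [List.mem_filter, decide_eq_true_eq] at hb
        exact habove b hb.1 hb.2
      · intro b hb c hc
        simp only [List.mem_filter, List.mem_cons, decide_eq_true_eq] at hb hc
        rcases hc with rfl | hc
        · exact hb.2
        · exact htrans _ _ _ hb.2 (habove c hc.1 hc.2)

end SMB

namespace SMB

open MvPolynomial

section Spanning

variable (K : Type) [Field K] {r d : ℕ}

/-- The rows of the transpose of the matrix `[1 | X]`, with `X` the generic matrix. -/
noncomputable def extendedGeneric : Fin r ⊕ Fin d → Fin r → KZ K r d :=
  Sum.elim (fun i => Pi.single i 1) fun j i => X (i, j)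

/-- The position of a column of `[1 | X]`: first the columns of `X`, then those of the identity
matrix in reverse order. -/
def columnKey : Fin r ⊕ Fin d → ℕ :=
  Sum.elim (fun i => d + (r - 1 - i)) fun j => j

theorem columnKey_inl (i : Fin r) :
    columnKey (Sum.inl i : Fin r ⊕ Fin d) = d + (r - 1 - i) :=
  rfl

@[simp]
theorem columnKey_inr (j : Fin d) : columnKey (Sum.inr j : Fin r ⊕ Fin d) = j :=
  rfl

open Classical in
/-- The maximal minor of `[1 | X]` corresponding to a minor of `X`: the `k`-th chosen column of `X`
is put in place of the column of the identity matrix indexed by the `k`-th chosen row. -/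
noncomputable def PairIx.columns (x : PairIx r d) (i : Fin r) : Fin r ⊕ Fin d :=
  if h : ∃ k, x.rows k = i then Sum.inr (x.cols h.choose) else Sum.inl i

theorem PairIx.columns_rows (x : PairIx r d) (k : Fin x.s) :
    x.columns (x.rows k) = Sum.inr (x.cols k) := by
  have h : ∃ l, x.rows l = x.rows k := ⟨k, rfl⟩
  rw [PairIx.columns, dif_pos h, x.rmono.injective h.choose_spec]

theorem PairIx.columns_of_not_mem (x : PairIx r d) {i : Fin r} (h : ¬ ∃ k, x.rows k = i) :
    x.columns i = Sum.inl i :=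
  dif_neg h

theorem PairIx.columns_injective (x : PairIx r d) : Function.Injective x.columns := by
  intro i j hij
  by_cases hi : ∃ k, x.rows k = i <;> by_cases hj : ∃ k, x.rows k = j
  · obtain ⟨k, rfl⟩ := hi
    obtain ⟨l, rfl⟩ := hj
    rw [x.columns_rows, x.columns_rows, Sum.inr.injEq] at hij
    rw [x.cmono.injective hij]
  · obtain ⟨k, rfl⟩ := hi
    rw [x.columns_rows, x.columns_of_not_mem hj] at hij
    cases hij
  · obtain ⟨k, rfl⟩ := hj
    rw [x.columns_rows, x.columns_of_not_mem hi] at hij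
    cases hij
  · rw [x.columns_of_not_mem hi, x.columns_of_not_mem hj, Sum.inl.injEq] at hij
    exact hij

theorem bracket_columns (x : PairIx r d) :
    bracket (extendedGeneric K) x.columns = minorPoly K r d x := by
  classical
  rw [bracket, Matrix.twoBlockTriangular_det _ fun i => ∃ k, x.rows k = i]
  · have h2 : Matrix.toSquareBlockProp (Matrix.of fun i => extendedGeneric K (x.columns i))
        (fun i => ¬ ∃ k, x.rows k = i) = 1 := by
      ext ⟨i, hi⟩ ⟨j, hj⟩ : 2
      simp only [Matrix.toSquareBlockProp_def, Matrix.of_apply, x.columns_of_not_mem hi,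
        extendedGeneric, Sum.elim_inl, Matrix.one_apply, Pi.single_apply, Subtype.mk.injEq,
        eq_comm]
    let e : Fin x.s ≃ {i // ∃ k, x.rows k = i} := Equiv.ofInjective x.rows x.rmono.injective
    rw [h2, Matrix.det_one, mul_one, minorPoly, ← Matrix.det_transpose]
    refine (Matrix.det_submatrix_equiv_self e _).symm.trans ?_
    refine congrArg Matrix.det (Matrix.ext fun i j => ?_)
    change extendedGeneric K (x.columns (x.rows j)) (x.rows i) = X (x.rows i, x.cols j)
    rw [x.columns_rows]
    rfl
  · rintro i hi j ⟨k, rfl⟩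
    rw [Matrix.of_apply, x.columns_of_not_mem hi]
    exact Pi.single_eq_of_ne (fun h => hi ⟨k, h⟩) 1

theorem countBelow_columns_of_le (x : PairIx r d) {t : ℕ} (ht : t ≤ d) :
    countBelow columnKey x.columns t = Fintype.card {k // (x.cols k : ℕ) < t} := by
  classical
  rw [countBelow, Fintype.card_subtype, Fintype.card_subtype,
    ← Finset.card_image_of_injective _ x.rmono.injective]
  congr 1
  ext i
  simp only [Finset.mem_filter, Finset.mem_univ, true_and, Finset.mem_image]
  by_cases hi : ∃ k, x.rows k = i
  · obtain ⟨k, rfl⟩ := hi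
    simp [x.columns_rows, x.rmono.injective.eq_iff]
  · rw [x.columns_of_not_mem hi, columnKey_inl]
    refine iff_of_false (by omega) ?_
    rintro ⟨k, -, hk⟩
    exact hi ⟨k, hk⟩

theorem countBelow_columns_add (x : PairIx r d) {k : ℕ} (hk : k ≤ r) :
    countBelow columnKey x.columns (d + (r - k)) + k =
      r + Fintype.card {l // (x.rows l : ℕ) < k} := by
  classical
  rw [countBelow, Fintype.card_subtype, Fintype.card_subtype,
    ← Finset.card_image_of_injective _ x.rmono.injective]
  have h1 := Finset.card_filter_add_card_filter_not (s := (Finset.univ : Finset (Fin r)))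
    fun i => columnKey (x.columns i) < d + (r - k)
  have h2 := Finset.card_filter_add_card_filter_not
    (s := Finset.univ.filter fun i : Fin r => (i : ℕ) < k) fun i => ∃ l, x.rows l = i
  have h3 : (Finset.univ.filter fun i : Fin r => (i : ℕ) < k).card = k := by
    simp [Fin.card_filter_val_lt, hk]
  have h4 : (Finset.univ.filter fun i => ¬ columnKey (x.columns i) < d + (r - k)) =
      (Finset.univ.filter fun i : Fin r => (i : ℕ) < k).filter fun i => ¬ ∃ l, x.rows l = i := by
    ext i
    simp only [Finset.mem_filter, Finset.mem_univ, true_and]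
    by_cases hi : ∃ l, x.rows l = i
    · obtain ⟨l, rfl⟩ := hi
      have := (x.cols l).2
      rw [x.columns_rows, columnKey_inr]
      exact iff_of_false (by omega) fun h => h.2 ⟨l, rfl⟩
    · have := i.2
      rw [x.columns_of_not_mem hi, columnKey_inl, and_iff_left hi]
      omega
  have h5 : (Finset.univ.filter fun l => (x.rows l : ℕ) < k).image x.rows =
      (Finset.univ.filter fun i : Fin r => (i : ℕ) < k).filter fun i => ∃ l, x.rows l = i := by
    ext i
    simp only [Finset.mem_image, Finset.mem_filter, Finset.mem_univ, true_and]
    constructor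
    · rintro ⟨l, hl, rfl⟩
      exact ⟨hl, l, rfl⟩
    · rintro ⟨hl, l, rfl⟩
      exact ⟨l, hl, rfl⟩
  rw [h4] at h1
  rw [h3, ← h5] at h2
  rw [Finset.card_univ, Fintype.card_fin] at h1
  omega

theorem geTup_of_card_le {N s s' : ℕ} {f : Fin s → Fin N} {g : Fin s' → Fin N}
    (hf : StrictMono f) (hg : StrictMono g)
    (h : ∀ t ≤ N, Fintype.card {k // (f k : ℕ) < t} ≤ Fintype.card {k // (g k : ℕ) < t}) :
    geTup f g := by
  classical
  have hs : s ≤ s' := by simpa using h N le_rfl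
  refine ⟨hs, fun j => ?_⟩
  by_contra hlt
  have h1 := h (f j + 1) (f j).2
  rw [Fintype.card_subtype, Fintype.card_subtype] at h1
  have h2 : Finset.Iic j ⊆ Finset.univ.filter fun k => (f k : ℕ) < f j + 1 := by
    intro k hk
    rw [Finset.mem_filter]
    exact ⟨Finset.mem_univ _, Nat.lt_succ_of_le (hf.monotone (Finset.mem_Iic.1 hk))⟩
  have h3 : (Finset.univ.filter fun k => (g k : ℕ) < f j + 1) ⊆ Finset.Iio (Fin.castLE hs j) := by
    intro k hk
    rw [Finset.mem_filter] at hk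
    rw [Finset.mem_Iio]
    by_contra hle
    have h4 : g (Fin.castLE hs j) ≤ g k := hg.monotone (not_lt.1 hle)
    have h5 := hk.2
    exact hlt (h4.trans (Nat.le_of_lt_succ h5))
  have h4 := Finset.card_le_card h2
  have h5 := Finset.card_le_card h3
  rw [Fin.card_Iic] at h4
  rw [Fin.card_Iio, Fin.val_castLE] at h5
  omega

theorem PairIx.ge_of_countBelow_le {x y : PairIx r d}
    (h : ∀ t, countBelow columnKey x.columns t ≤ countBelow columnKey y.columns t) : x.ge y := by
  constructor
  · refine geTup_of_card_le x.rmono y.rmono fun k hk => ?_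
    have := h (d + (r - k))
    have := countBelow_columns_add x hk
    have := countBelow_columns_add y hk
    omega
  · refine geTup_of_card_le x.cmono y.cmono fun t ht => ?_
    rw [← countBelow_columns_of_le x ht, ← countBelow_columns_of_le y ht]
    exact h t

theorem exists_columns_eq_comp (c : Fin r → Fin r ⊕ Fin d) (hc : Function.Injective c) :
    ∃ (x : PairIx r d) (σ : Equiv.Perm (Fin r)), x.columns = c ∘ σ := by
  classical
  set A : Finset (Fin r) := (Finset.univ.filter fun i => Sum.inl i ∈ Set.range c)ᶜ with hA
  set B : Finset (Fin d) := Finset.univ.filter fun j => Sum.inr j ∈ Set.range c with hB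
  have hcard : B.card = A.card := by
    have h1 : (Finset.univ.image c).card = r := by
      rw [Finset.card_image_of_injective _ hc, Finset.card_fin]
    have h2 : Finset.univ.image c =
        (Finset.univ.filter fun i => Sum.inl i ∈ Set.range c).disjSum B := by
      ext (i | j) <;> simp [hB]
    rw [h2, Finset.card_disjSum] at h1
    rw [hA, Finset.card_compl, Fintype.card_fin]
    omega
  set x : PairIx r d := ⟨A.card, A.orderEmbOfFin rfl, B.orderEmbOfFin hcard,
    (A.orderEmbOfFin rfl).strictMono, (B.orderEmbOfFin hcard).strictMono⟩ with hx
  have hmem : ∀ i, ∃ j, c j = x.columns i := by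
    intro i
    by_cases hi : ∃ k, x.rows k = i
    · obtain ⟨k, rfl⟩ := hi
      rw [x.columns_rows]
      exact (Finset.mem_filter.1 (B.orderEmbOfFin_mem hcard k)).2
    · rw [x.columns_of_not_mem hi]
      by_contra hni
      have hiA : i ∈ A := Finset.mem_compl.2 fun h => hni (Finset.mem_filter.1 h).2
      have : i ∈ Set.range (A.orderEmbOfFin rfl) := by
        rw [Finset.range_orderEmbOfFin]
        exact hiA
      exact hi this
  choose τ hτ using hmem
  have hinj : Function.Injective τ := fun i j hij =>
    x.columns_injective (by rw [← hτ, ← hτ, hij])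
  exact ⟨x, Equiv.ofBijective τ (Finite.injective_iff_bijective.1 hinj), funext fun i => (hτ i).symm⟩

theorem countBelow_comp_perm {n : ℕ} {E : Type*} (key : E → ℕ) (c : Fin n → E)
    (σ : Equiv.Perm (Fin n)) : countBelow key (c ∘ σ) = countBelow key c :=
  funext fun _ => Fintype.card_congr (σ.subtypeEquiv fun _ => Iff.rfl)

theorem exists_pairIx_of_injective (c : Fin r → Fin r ⊕ Fin d) (hc : Function.Injective c) :
    ∃ x : PairIx r d, countBelow columnKey x.columns = countBelow columnKey c ∧
      (bracket (extendedGeneric K) c = minorPoly K r d x ∨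
        bracket (extendedGeneric K) c = -minorPoly K r d x) := by
  obtain ⟨x, σ, hσ⟩ := exists_columns_eq_comp c hc
  refine ⟨x, by rw [hσ, countBelow_comp_perm], ?_⟩
  have h : minorPoly K r d x = (Equiv.Perm.sign σ : ℤ) * bracket (extendedGeneric K) c := by
    rw [← bracket_columns, hσ]
    exact Matrix.det_permute σ (Matrix.of fun i => extendedGeneric K (c i))
  rcases Int.units_eq_one_or (Equiv.Perm.sign σ) with hs | hs <;> simp [h, hs]

theorem exists_standard_of_pairwise (l : List (Fin r → Fin r ⊕ Fin d))
    (hinj : ∀ c ∈ l, Function.Injective c)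
    (hl : l.Pairwise fun c c' => ∀ t, countBelow columnKey c t ≤ countBelow columnKey c' t) :
    ∃ L : List {x : PairIx r d // 0 < x.s}, (L.Pairwise fun a b => PairIx.ge a.val b.val) ∧
      (∀ x ∈ L, ∃ c ∈ l, countBelow columnKey x.val.columns = countBelow columnKey c) ∧
      ((l.map (bracket (extendedGeneric K))).prod = (L.map fun x => minorPoly K r d x.val).prod ∨
        (l.map (bracket (extendedGeneric K))).prod =
          -(L.map fun x => minorPoly K r d x.val).prod) := by
  induction l with
  | nil => exact ⟨[], by simp⟩
  | cons c l ih =>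
    rw [List.pairwise_cons] at hl
    obtain ⟨L, hL, hmem, hprod⟩ := ih (fun c hc => hinj c (List.mem_cons_of_mem _ hc)) hl.2
    obtain ⟨x, hx, hxc⟩ := exists_pairIx_of_injective K c (hinj c (by simp))
    have hmem' : ∀ y ∈ L, ∃ c' ∈ c :: l,
        countBelow columnKey y.val.columns = countBelow columnKey c' := fun y hy =>
      (hmem y hy).imp fun c' h => ⟨List.mem_cons_of_mem _ h.1, h.2⟩
    rcases Nat.eq_zero_or_pos x.s with hs | hs
    · refine ⟨L, hL, hmem', ?_⟩
      have : IsEmpty (Fin x.s) := by rw [hs]; infer_instance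
      rw [minorPoly, Matrix.det_isEmpty] at hxc
      rcases hxc with h | h <;> rcases hprod with h' | h' <;> simp [h, h']
    · refine ⟨⟨x, hs⟩ :: L, List.pairwise_cons.2 ⟨fun y hy => ?_, hL⟩, ?_, ?_⟩
      · obtain ⟨c', hc', hyc⟩ := hmem y hy
        refine PairIx.ge_of_countBelow_le ?_
        rw [hx, hyc]
        exact hl.1 c' hc'
      · intro y hy
        rcases List.mem_cons.1 hy with rfl | hy
        · exact ⟨c, by simp, hx⟩
        · exact hmem' y hy
      · rcases hxc with h | h <;> rcases hprod with h' | h' <;> simp [h, h']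

theorem prod_bracket_mem_span_standard (m : Multiset (Fin r → Fin r ⊕ Fin d))
    (hm : ∀ c ∈ m, ∀ c' ∈ m, (∀ t, countBelow columnKey c t ≤ countBelow columnKey c' t) ∨
      ∀ t, countBelow columnKey c' t ≤ countBelow columnKey c t) :
    (m.map (bracket (extendedGeneric K))).prod ∈ Submodule.span K
      (Set.range (fun L : {L : List {x : PairIx r d // 0 < x.s} //
          L.IsChain fun a b => PairIx.ge a.val b.val} =>
        (L.val.map fun x => minorPoly K r d x.val).prod)) := by
  by_cases hinj : ∀ c ∈ m, Function.Injective c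
  · obtain ⟨l, hperm, hl⟩ := exists_perm_pairwise
      (fun c c' : Fin r → Fin r ⊕ Fin d => ∀ t, countBelow columnKey c t ≤ countBelow columnKey c' t)
      (fun a b c h h' t => (h t).trans (h' t)) m.toList
      (by simpa only [Multiset.mem_toList] using hm)
    obtain rfl : m = l := by rw [← m.coe_toList]; exact (Multiset.coe_eq_coe.2 hperm).symm
    obtain ⟨L, hL, -, hprod⟩ := exists_standard_of_pairwise K l (by simpa using hinj) hl
    have hmem : (L.map fun x => minorPoly K r d x.val).prod ∈ Submodule.span K
        (Set.range (fun L : {L : List {x : PairIx r d // 0 < x.s} //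
            L.IsChain fun a b => PairIx.ge a.val b.val} =>
          (L.val.map fun x => minorPoly K r d x.val).prod)) :=
      Submodule.subset_span ⟨⟨L, List.isChain_iff_pairwise.2 hL⟩, rfl⟩
    rw [Multiset.map_coe, Multiset.prod_coe]
    rcases hprod with h | h <;> rw [h]
    · exact hmem
    · exact neg_mem hmem
  · push Not at hinj
    obtain ⟨c, hc, hinj⟩ := hinj
    obtain ⟨i, j, hij, hne⟩ := Function.not_injective_iff.1 hinj
    have hzero : bracket (extendedGeneric K) c = 0 :=
      Matrix.det_zero_of_row_eq hne (congrArg (extendedGeneric K) hij)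
    rw [Multiset.prod_eq_zero (Multiset.mem_map.2 ⟨c, hc, hzero⟩)]
    exact zero_mem _

theorem bracket_single_column (i : Fin r) (j : Fin d) :
    ∃ c : Fin r → Fin r ⊕ Fin d, bracket (extendedGeneric K) c = X (i, j) :=
  ⟨PairIx.columns ⟨1, fun _ => i, fun _ => j, Subsingleton.strictMono _, Subsingleton.strictMono _⟩,
    by rw [bracket_columns]; simp [minorPoly]⟩

theorem span_standard : Submodule.span K
    (Set.range (fun L : {L : List {x : PairIx r d // 0 < x.s} //
        L.IsChain fun a b => PairIx.ge a.val b.val} =>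
      (L.val.map fun x => minorPoly K r d x.val).prod)) = ⊤ := by
  rw [eq_top_iff]
  have hadj : Algebra.adjoin K (Set.range (bracket (extendedGeneric K (r := r) (d := d)))) = ⊤ := by
    rw [eq_top_iff, ← MvPolynomial.adjoin_range_X]
    refine Algebra.adjoin_mono ?_
    rintro _ ⟨⟨i, j⟩, rfl⟩
    exact bracket_single_column K i j
  rw [← Algebra.top_toSubmodule, ← hadj, Algebra.adjoin_eq_span, Submodule.span_le]
  intro f hf
  obtain ⟨s, hs, rfl⟩ := Submonoid.exists_multiset_of_mem_closure hf
  obtain ⟨m, rfl⟩ : ∃ m : Multiset (Fin r → Fin r ⊕ Fin d),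
      m.map (bracket (extendedGeneric K)) = s := by
    have : Nonempty (Fin r → Fin r ⊕ Fin d) := ⟨Sum.inl⟩
    choose! g hg using hs
    exact ⟨s.map g, by rw [Multiset.map_map]; exact Multiset.map_congr rfl hg |>.trans s.map_id⟩
  refine Submodule.span_le.2 ?_ (prod_bracket_mem_span K (extendedGeneric K) columnKey (d + r) ?_ m)
  · rintro _ ⟨m', hm', rfl⟩
    exact prod_bracket_mem_span_standard K m' hm'
  · rintro (i | j)
    · simp only [columnKey, Sum.elim_inl]
      omega
    · simp only [columnKey, Sum.elim_inr]
      omega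

end Spanning

end SMB

open SMB in
/-- **Standard monomial basis for `K[Z]` (Doubilet–Rota–Stein).**
The standard monomials in the minors `p(A,B)` of the generic `r×d` matrix (products over
weakly decreasing chains of index pairs with `1 ≤ |A| = |B|`, the empty product being `1`)
are linearly independent over `K` and span `K[Z]`; that is, they form a `K`-basis of the
polynomial ring `K[Z]`. -/
theorem generic_matrix_standard_monomial_basis (K : Type) [Field K] [IsAlgClosed K]
    (r d : ℕ) (hr : 0 < r) (hd : 0 < d) :
    LinearIndependent K
      (fun L : {L : List {x : PairIx r d // 0 < x.s} //
          L.Chain' fun a b => PairIx.ge a.val b.val} =>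
        (L.val.map fun x => minorPoly K r d x.val).prod) ∧
    Submodule.span K
      (Set.range (fun L : {L : List {x : PairIx r d // 0 < x.s} //
          L.Chain' fun a b => PairIx.ge a.val b.val} =>
        (L.val.map fun x => minorPoly K r d x.val).prod)) = ⊤ := by
  exact ⟨linearIndependent_standard K, span_standard K⟩
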